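/- Let p, q, r > 2 be pairwise coprime integers with p the smallest. Let u = x_1, v = y_1, and set μ = min(x_q, x_r, p − x_q, p − x_r) and C = ⌊μ/u⌋. Assume u ≤ μ (so C ≥ 1), q > p², and v > q − q/p². Then the coefficient set A_{p,q,r} of Q_{p,q,r} contains every integer n with |n| ≤ C. -/

import Mathlib

open Polynomial

/-- The ternary inclusion-exclusion polynomial `Q_{p,q,r}`. -/
noncomputable def Qpoly (p q r : ℕ) : Polynomial ℤ :=
  ((X ^ (p * q * r) - 1) * (X ^ p - 1) * (X ^ q - 1) * (X ^ r - 1)) /ₘ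
    ((X ^ (p * q) - 1) * (X ^ (q * r) - 1) * (X ^ (r * p) - 1) * (X - 1))

/-- The set `A_{p,q,r}` of coefficients of `Q_{p,q,r}` (whose degree is `(p-1)(q-1)(r-1)`). -/
noncomputable def coeffSet (p q r : ℕ) : Set ℤ :=
  {n : ℤ | ∃ m : ℕ, m ≤ (p - 1) * (q - 1) * (r - 1) ∧ (Qpoly p q r).coeff m = n}

section
variable {p q r : ℕ}

/-- `X ^ n - 1` as a product of powers of cyclotomic polynomials indexed by the divisors of a
multiple `N` of `n`. -/
lemma X_pow_sub_one_eq_prod_divisors {n N : ℕ} (hn : n ∣ N) (hN : N ≠ 0) :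
    (X ^ n - 1 : ℤ[X]) = ∏ d ∈ N.divisors, cyclotomic d ℤ ^ (if d ∣ n then 1 else 0) := by
  have hn0 : 0 < n := Nat.pos_of_ne_zero (by rintro rfl; exact hN (by simpa using hn))
  rw [← prod_cyclotomic_eq_X_pow_sub_one hn0]
  have : n.divisors = N.divisors.filter (· ∣ n) := by
    ext d
    simp only [Nat.mem_divisors, Finset.mem_filter]
    exact ⟨fun h => ⟨⟨h.1.trans hn, hN⟩, h.1⟩, fun h => ⟨h.2, hn0.ne'⟩⟩
  rw [this, Finset.prod_filter]
  refine Finset.prod_congr rfl fun d _ => ?_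
  split_ifs <;> simp

/-- A common divisor of `a * b` and `b * c` divides `b` when `a` and `c` are coprime. -/
lemma dvd_of_dvd_mul_of_dvd_mul {a b c d : ℕ} (hac : Nat.Coprime a c) (h₁ : d ∣ a * b)
    (h₂ : d ∣ b * c) : d ∣ b := by
  have h := Nat.dvd_gcd h₁ h₂
  rwa [mul_comm a b, Nat.gcd_mul_left, hac.gcd_eq_one, mul_one] at h

lemma Qpoly_denominator_dvd_numerator (hp : 0 < p) (hq : 0 < q) (hr : 0 < r)
    (cpq : Nat.Coprime p q) (cpr : Nat.Coprime p r) (cqr : Nat.Coprime q r) :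
    ((X ^ (p * q) - 1) * (X ^ (q * r) - 1) * (X ^ (r * p) - 1) * (X - 1) : ℤ[X]) ∣
      (X ^ (p * q * r) - 1) * (X ^ p - 1) * (X ^ q - 1) * (X ^ r - 1) := by
  have hN : p * q * r ≠ 0 := by positivity
  have h1 : (X - 1 : ℤ[X]) = X ^ 1 - 1 := by simp
  rw [h1, X_pow_sub_one_eq_prod_divisors (dvd_mul_right (p * q) r) hN,
    X_pow_sub_one_eq_prod_divisors (n := q * r) ⟨p, by ring⟩ hN,
    X_pow_sub_one_eq_prod_divisors (n := r * p) ⟨q, by ring⟩ hN,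
    X_pow_sub_one_eq_prod_divisors (one_dvd _) hN,
    X_pow_sub_one_eq_prod_divisors dvd_rfl hN,
    X_pow_sub_one_eq_prod_divisors (n := p) ⟨q * r, by ring⟩ hN,
    X_pow_sub_one_eq_prod_divisors (n := q) ⟨p * r, by ring⟩ hN,
    X_pow_sub_one_eq_prod_divisors (n := r) ⟨p * q, by ring⟩ hN]
  simp only [← Finset.prod_mul_distrib, ← pow_add]
  refine Finset.prod_dvd_prod_of_dvd _ _ fun d hd => pow_dvd_pow _ ?_
  have hdN := Nat.dvd_of_mem_divisors hd
  have e1 : d ∣ p * q → d ∣ q * r → d ∣ q := dvd_of_dvd_mul_of_dvd_mul cpr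
  have e2 : d ∣ q * r → d ∣ r * p → d ∣ r := dvd_of_dvd_mul_of_dvd_mul cpq.symm
  have e3 : d ∣ r * p → d ∣ p * q → d ∣ p := dvd_of_dvd_mul_of_dvd_mul cqr.symm
  have f1 : d ∣ p → d ∣ q → d ∣ 1 := fun a b => cpq.gcd_eq_one ▸ Nat.dvd_gcd a b
  have g1 : d ∣ 1 → d ∣ p := fun a => a.trans (one_dvd _)
  have g2 : d ∣ 1 → d ∣ q := fun a => a.trans (one_dvd _)
  have g3 : d ∣ 1 → d ∣ r := fun a => a.trans (one_dvd _)
  clear hd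
  split_ifs <;> omega

lemma Qpoly_denominator_monic (hp : 0 < p) (hq : 0 < q) (hr : 0 < r) :
    ((X ^ (p * q) - 1) * (X ^ (q * r) - 1) * (X ^ (r * p) - 1) * (X - 1) : ℤ[X]).Monic := by
  have h : ∀ n : ℕ, 0 < n → (X ^ n - 1 : ℤ[X]).Monic := fun n hn => by
    simpa using monic_X_pow_sub_C (1 : ℤ) hn.ne'
  exact (((h _ (by positivity)).mul (h _ (by positivity))).mul (h _ (by positivity))).mul
    (by simpa using h 1 one_pos)

lemma Qpoly_mul_denominator (hp : 0 < p) (hq : 0 < q) (hr : 0 < r)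
    (cpq : Nat.Coprime p q) (cpr : Nat.Coprime p r) (cqr : Nat.Coprime q r) :
    Qpoly p q r * ((X ^ (p * q) - 1) * (X ^ (q * r) - 1) * (X ^ (r * p) - 1) * (X - 1)) =
      (X ^ (p * q * r) - 1) * (X ^ p - 1) * (X ^ q - 1) * (X ^ r - 1) := by
  rw [mul_comm]
  have h := modByMonic_add_div ((X ^ (p * q * r) - 1) * (X ^ p - 1) * (X ^ q - 1) * (X ^ r - 1))
    ((X ^ (p * q) - 1) * (X ^ (q * r) - 1) * (X ^ (r * p) - 1) * (X - 1) : ℤ[X])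
  rw [(modByMonic_eq_zero_iff_dvd (Qpoly_denominator_monic hp hq hr)).2
    (Qpoly_denominator_dvd_numerator hp hq hr cpq cpr cqr), zero_add] at h
  exact h

lemma natDegree_Qpoly_le (hp : 0 < p) (hq : 0 < q) (hr : 0 < r) :
    (Qpoly p q r).natDegree ≤ (p - 1) * (q - 1) * (r - 1) := by
  have hd : ∀ n : ℕ, (X ^ n - 1 : ℤ[X]).natDegree = n := fun n => by
    simpa using natDegree_X_pow_sub_C (R := ℤ) (n := n) (r := 1)
  have hm : ∀ n : ℕ, 0 < n → (X ^ n - 1 : ℤ[X]).Monic := fun n hn => by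
    simpa using monic_X_pow_sub_C (1 : ℤ) hn.ne'
  have h1 : (X - 1 : ℤ[X]) = X ^ 1 - 1 := by simp
  have h := natDegree_divByMonic
    ((X ^ (p * q * r) - 1) * (X ^ p - 1) * (X ^ q - 1) * (X ^ r - 1) : ℤ[X])
    (Qpoly_denominator_monic hp hq hr)
  have m1 := hm (p * q) (by positivity)
  have m2 := hm (q * r) (by positivity)
  have m3 := hm (r * p) (by positivity)
  have m4 := hm (p * q * r) (by positivity)
  have m5 := hm p hp
  have m6 := hm q hq
  have m7 := hm r hr
  have m8 := hm 1 one_pos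
  rw [h1, ((m1.mul m2).mul m3).natDegree_mul m8, (m1.mul m2).natDegree_mul m3,
    m1.natDegree_mul m2, ((m4.mul m5).mul m6).natDegree_mul m7, (m4.mul m5).natDegree_mul m6,
    m4.natDegree_mul m5] at h
  simp only [hd] at h
  rw [Qpoly, h1, h]
  obtain ⟨a, rfl⟩ : ∃ a, p = a + 1 := ⟨p - 1, by omega⟩
  obtain ⟨b, rfl⟩ : ∃ b, q = b + 1 := ⟨q - 1, by omega⟩
  obtain ⟨c, rfl⟩ : ∃ c, r = c + 1 := ⟨r - 1, by omega⟩
  simp only [Nat.add_sub_cancel]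
  rw [Nat.sub_le_iff_le_add]
  apply le_of_eq
  ring

/-- The polynomial `∑ X ^ (a q r + b p r + c p q)` over the box `a < p`, `b < q`, `c < r`. -/
noncomputable def ternaryBox (p q r : ℕ) : ℤ[X] :=
  ∑ a ∈ Finset.range p, ∑ b ∈ Finset.range q, ∑ c ∈ Finset.range r,
    X ^ (a * (q * r) + b * (r * p) + c * (p * q))

lemma ternaryBox_mul (p q r : ℕ) :
    ternaryBox p q r * ((X ^ (p * q) - 1) * (X ^ (q * r) - 1) * (X ^ (r * p) - 1)) =
      (X ^ (p * q * r) - 1) ^ 3 := by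
  have h : ternaryBox p q r = (∑ a ∈ Finset.range p, (X ^ (q * r)) ^ a) *
      (∑ b ∈ Finset.range q, (X ^ (r * p)) ^ b) * (∑ c ∈ Finset.range r, (X ^ (p * q)) ^ c) := by
    rw [ternaryBox, Finset.sum_mul_sum, Finset.sum_mul]
    refine Finset.sum_congr rfl fun a _ => ?_
    rw [Finset.sum_mul_sum]
    refine Finset.sum_congr rfl fun b _ => Finset.sum_congr rfl fun c _ => ?_
    ring
  have h1 := geom_sum_mul (X ^ (q * r) : ℤ[X]) p
  have h2 := geom_sum_mul (X ^ (r * p) : ℤ[X]) q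
  have h3 := geom_sum_mul (X ^ (p * q) : ℤ[X]) r
  rw [← pow_mul] at h1 h2 h3
  rw [show q * r * p = p * q * r by ring] at h1
  rw [show r * p * q = p * q * r by ring] at h2
  rw [h]
  calc _ = ((∑ a ∈ Finset.range p, (X ^ (q * r)) ^ a) * (X ^ (q * r) - 1 : ℤ[X])) *
        ((∑ b ∈ Finset.range q, (X ^ (r * p)) ^ b) * (X ^ (r * p) - 1)) *
        ((∑ c ∈ Finset.range r, (X ^ (p * q)) ^ c) * (X ^ (p * q) - 1)) := by ring
    _ = _ := by rw [h1, h2, h3]; ring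

lemma Qpoly_mul_sq (hp : 0 < p) (hq : 0 < q) (hr : 0 < r)
    (cpq : Nat.Coprime p q) (cpr : Nat.Coprime p r) (cqr : Nat.Coprime q r) :
    Qpoly p q r * (X ^ (p * q * r) - 1) ^ 2 =
      (∑ j ∈ Finset.range p, X ^ j) * ((X ^ q - 1) * ((X ^ r - 1) * ternaryBox p q r)) := by
  have hne : ∀ n : ℕ, 0 < n → (X ^ n - 1 : ℤ[X]) ≠ 0 := fun n hn => by
    simpa using X_pow_sub_C_ne_zero hn (1 : ℤ)
  have hX : (X - 1 : ℤ[X]) ≠ 0 := by simpa using hne 1 one_pos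
  have hN := hne (p * q * r) (by positivity)
  have h1 := Qpoly_mul_denominator hp hq hr cpq cpr cqr
  have h2 := ternaryBox_mul p q r
  have h3 := geom_sum_mul (X : ℤ[X]) p
  refine mul_right_cancel₀ (mul_ne_zero hN hX) ?_
  calc _ = Qpoly p q r * (X - 1) * (X ^ (p * q * r) - 1) ^ 3 := by ring
    _ = Qpoly p q r * ((X ^ (p * q) - 1) * (X ^ (q * r) - 1) * (X ^ (r * p) - 1) * (X - 1)) *
        ternaryBox p q r := by rw [← h2]; ring
    _ = _ := by rw [h1, ← h3]; ring

/-- Coefficients of an integer polynomial, extended by zero to negative indices. -/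
noncomputable def intCoeff (P : ℤ[X]) (n : ℤ) : ℤ := if 0 ≤ n then P.coeff n.toNat else 0

lemma intCoeff_natCast (P : ℤ[X]) (n : ℕ) : intCoeff P n = P.coeff n := by simp [intCoeff]

lemma intCoeff_of_neg (P : ℤ[X]) {n : ℤ} (hn : n < 0) : intCoeff P n = 0 := by
  simp [intCoeff, hn]

lemma intCoeff_X_pow_mul (P : ℤ[X]) (k : ℕ) (n : ℤ) :
    intCoeff (X ^ k * P) n = intCoeff P (n - k) := by
  unfold intCoeff
  rw [coeff_X_pow_mul']
  by_cases h : (k : ℤ) ≤ n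
  · have h0 : 0 ≤ n := by omega
    rw [if_pos h0, if_pos (by omega), if_pos (by omega)]
    congr 1
    omega
  · rw [if_neg (c := 0 ≤ n - k) (by omega)]
    split_ifs <;> first | rfl | omega

lemma intCoeff_sub (P R : ℤ[X]) (n : ℤ) : intCoeff (P - R) n = intCoeff P n - intCoeff R n := by
  unfold intCoeff
  split_ifs <;> simp

lemma intCoeff_X_pow_sub_one_mul (P : ℤ[X]) (k : ℕ) (n : ℤ) :
    intCoeff ((X ^ k - 1) * P) n = intCoeff P (n - k) - intCoeff P n := by
  rw [sub_mul, one_mul, intCoeff_sub, intCoeff_X_pow_mul]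

lemma intCoeff_sum_X_pow_mul (P : ℤ[X]) (k : ℕ) (n : ℤ) :
    intCoeff ((∑ j ∈ Finset.range k, X ^ j) * P) n =
      ∑ j ∈ Finset.range k, intCoeff P (n - j) := by
  simp only [← intCoeff_X_pow_mul]
  unfold intCoeff
  split_ifs <;> simp [Finset.sum_mul, finsetSum_coeff]

/-- The sum of `p` consecutive coefficients of the box polynomial, ending at index `n`. -/
noncomputable def windowSum (p q r : ℕ) (n : ℤ) : ℤ :=
  ∑ j ∈ Finset.range p, intCoeff (ternaryBox p q r) (n - j)

lemma Qpoly_coeff_eq (hp : 0 < p) (hq : 0 < q) (hr : 0 < r)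
    (cpq : Nat.Coprime p q) (cpr : Nat.Coprime p r) (cqr : Nat.Coprime q r)
    (m : ℕ) (hm : m < p * q * r) :
    (Qpoly p q r).coeff m = windowSum p q r m - windowSum p q r (m - q) -
      windowSum p q r (m - r) + windowSum p q r (m - q - r) := by
  have h := congrArg (intCoeff · (m : ℤ)) (Qpoly_mul_sq hp hq hr cpq cpr cqr)
  have hL : Qpoly p q r * (X ^ (p * q * r) - 1) ^ 2 =
      (X ^ (p * q * r) - 1) * ((X ^ (p * q * r) - 1) * Qpoly p q r) := by ring
  have hneg : (m : ℤ) - (p * q * r : ℕ) < 0 := by omega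
  simp only [hL, intCoeff_X_pow_sub_one_mul, intCoeff_sum_X_pow_mul] at h
  rw [intCoeff_of_neg _ hneg, intCoeff_of_neg _ (by omega), intCoeff_natCast] at h
  rw [show (Qpoly p q r).coeff m = 0 - 0 - (0 - (Qpoly p q r).coeff m) by ring, h]
  simp only [windowSum, ← Finset.sum_sub_distrib, ← Finset.sum_add_distrib]
  refine Finset.sum_congr rfl fun j _ => ?_
  rw [show (m : ℤ) - q - j = m - j - q by ring, show (m : ℤ) - r - j = m - j - r by ring,
    show (m : ℤ) - q - r - j = m - j - q - r by ring]
  ring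

lemma coeff_ternaryBox (p q r n : ℕ) :
    (ternaryBox p q r).coeff n = ∑ a ∈ Finset.range p, ∑ b ∈ Finset.range q, ∑ c ∈ Finset.range r,
      if n = a * (q * r) + b * (r * p) + c * (p * q) then 1 else 0 := by
  simp [ternaryBox, finsetSum_coeff, coeff_X_pow]

lemma intCoeff_ternaryBox_eq_zero_of_forall {n : ℤ}
    (h : ∀ a b c : ℤ, 0 ≤ a → 0 ≤ b → 0 ≤ c → n ≠ a * (q * r) + b * (r * p) + c * (p * q)) :
    intCoeff (ternaryBox p q r) n = 0 := by
  unfold intCoeff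
  split_ifs with hn
  · lift n to ℕ using hn
    rw [Int.toNat_natCast, coeff_ternaryBox]
    refine Finset.sum_eq_zero fun a _ => Finset.sum_eq_zero fun b _ =>
      Finset.sum_eq_zero fun c _ => if_neg fun e => ?_
    exact h a b c (by positivity) (by positivity) (by positivity) (by exact_mod_cast e)
  · rfl

/-- A nonnegative integer congruent to `b < q` modulo `q` is at least `b`. -/
lemma le_of_dvd_sub_of_lt {k b b' : ℤ} (hb : b < k) (hb' : 0 ≤ b') (h : k ∣ b' - b) : b ≤ b' := by
  obtain ⟨t, ht⟩ := h
  by_contra! hlt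
  have : t < 0 := by
    by_contra! h0
    nlinarith
  nlinarith

lemma dvd_sub_of_dvd_sub_mul {k m n a b : ℤ} (hk : IsCoprime k m) (h : k ∣ n - b * m)
    (h' : k ∣ n - a * m) : k ∣ a - b := by
  refine hk.dvd_of_dvd_mul_right ?_
  have := dvd_sub h h'
  rwa [show n - b * m - (n - a * m) = (a - b) * m by ring] at this

lemma isCoprime_mul_cast (h₁ : Nat.Coprime p q) (h₂ : Nat.Coprime p r) :
    IsCoprime (p : ℤ) ((q : ℤ) * r) :=
  (Nat.isCoprime_iff_coprime.2 h₁).mul_right (Nat.isCoprime_iff_coprime.2 h₂)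

/-- The box polynomial has zero coefficient at `n` when `n` is too small for its residue class
modulo `q`. -/
lemma intCoeff_ternaryBox_eq_zero_of_mod (cpq : Nat.Coprime p q) (cqr : Nat.Coprime q r)
    {n b : ℤ} (hb : b < q) (hn : (q : ℤ) ∣ n - b * (r * p)) (hlt : n < b * (r * p)) :
    intCoeff (ternaryBox p q r) n = 0 := by
  refine intCoeff_ternaryBox_eq_zero_of_forall fun a' b' c' ha' hb' hc' e => ?_
  have hbb : b ≤ b' := le_of_dvd_sub_of_lt hb hb' <|
    dvd_sub_of_dvd_sub_mul (isCoprime_mul_cast cqr cpq.symm) hn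
      ⟨a' * r + c' * p, by rw [e]; ring⟩
  have h1 : b * ((r : ℤ) * p) ≤ b' * (r * p) := by gcongr
  have h2 : 0 ≤ a' * ((q : ℤ) * r) := by positivity
  have h3 : 0 ≤ c' * ((p : ℤ) * q) := by positivity
  linarith

/-- The box polynomial has zero coefficient at `n` when `n` is too small for its residue classes
modulo `p` and `q`. -/
lemma intCoeff_ternaryBox_eq_zero (cpq : Nat.Coprime p q) (cpr : Nat.Coprime p r)
    (cqr : Nat.Coprime q r) {n a b : ℤ} (ha : a < p) (hb : b < q)
    (hna : (p : ℤ) ∣ n - a * (q * r)) (hnb : (q : ℤ) ∣ n - b * (r * p))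
    (hlt : n < a * (q * r) + b * (r * p)) :
    intCoeff (ternaryBox p q r) n = 0 := by
  refine intCoeff_ternaryBox_eq_zero_of_forall fun a' b' c' ha' hb' hc' e => ?_
  have haa : a ≤ a' := le_of_dvd_sub_of_lt ha ha' <|
    dvd_sub_of_dvd_sub_mul (isCoprime_mul_cast cpq cpr) hna
      ⟨b' * r + c' * q, by rw [e]; ring⟩
  have hbb : b ≤ b' := le_of_dvd_sub_of_lt hb hb' <|
    dvd_sub_of_dvd_sub_mul (isCoprime_mul_cast cqr cpq.symm) hnb
      ⟨a' * r + c' * p, by rw [e]; ring⟩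
  have h0 : a * ((q : ℤ) * r) ≤ a' * (q * r) := by gcongr
  have h1 : b * ((r : ℤ) * p) ≤ b' * (r * p) := by gcongr
  have h3 : 0 ≤ c' * ((p : ℤ) * q) := by positivity
  linarith

lemma eq_of_box_eq {k m a a' s s' : ℕ} (hk : Nat.Coprime k m) (ha : a < k) (ha' : a' < k)
    (h : a * m + k * s = a' * m + k * s') : a = a' := by
  have h1 : a * m ≡ a' * m [MOD k] := by
    have := congrArg (· % k) h
    simpa [Nat.ModEq] using this
  exact Nat.ModEq.eq_of_lt_of_lt (Nat.ModEq.cancel_right_of_coprime hk h1) ha ha'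

lemma intCoeff_ternaryBox_eq_one (cpq : Nat.Coprime p q) (cpr : Nat.Coprime p r)
    (cqr : Nat.Coprime q r) {n a b c : ℤ} (ha0 : 0 ≤ a) (ha : a < p) (hb0 : 0 ≤ b) (hb : b < q)
    (hc0 : 0 ≤ c) (hc : c < r) (hn : n = a * (q * r) + b * (r * p) + c * (p * q)) :
    intCoeff (ternaryBox p q r) n = 1 := by
  lift a to ℕ using ha0
  lift b to ℕ using hb0
  lift c to ℕ using hc0
  obtain rfl : n = ((a * (q * r) + b * (r * p) + c * (p * q) : ℕ) : ℤ) := by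
    rw [hn]; push_cast; ring
  norm_cast at ha hb hc
  rw [intCoeff_natCast, coeff_ternaryBox]
  have key : ∀ a' ∈ Finset.range p, ∀ b' ∈ Finset.range q, ∀ c' ∈ Finset.range r,
      a * (q * r) + b * (r * p) + c * (p * q) = a' * (q * r) + b' * (r * p) + c' * (p * q) →
      a' = a ∧ b' = b ∧ c' = c := by
    intro a' ha' b' hb' c' hc' e
    rw [Finset.mem_range] at ha' hb' hc'
    refine ⟨(eq_of_box_eq (cpq.mul_right cpr) ha ha' (s := b * r + c * q)
      (s' := b' * r + c' * q) ?_).symm, (eq_of_box_eq (cqr.mul_right cpq.symm) hb hb'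
      (s := a * r + c * p) (s' := a' * r + c' * p) ?_).symm,
      (eq_of_box_eq (cpr.symm.mul_right cqr.symm) hc hc' (s := a * q + b * p)
      (s' := a' * q + b' * p) ?_).symm⟩ <;> linarith
  have hma := Finset.mem_range.2 ha
  have hmb := Finset.mem_range.2 hb
  have hmc := Finset.mem_range.2 hc
  rw [Finset.sum_eq_single_of_mem a hma, Finset.sum_eq_single_of_mem b hmb,
    Finset.sum_eq_single_of_mem c hmc, if_pos rfl]
  · exact fun c' hc' hne => if_neg fun e => hne (key a hma b hmb c' hc' e).2.2
  · exact fun b' hb' hne => Finset.sum_eq_zero fun c' hc' =>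
      if_neg fun e => hne (key a hma b' hb' c' hc' e).2.1
  · exact fun a' ha' hne => Finset.sum_eq_zero fun b' hb' => Finset.sum_eq_zero fun c' hc' =>
      if_neg fun e => hne (key a' ha' b' hb' c' hc' e).1

section window

variable {u V w s c Y l : ℤ}

/-- For indices `(l - 1) u q r - t` with `0 ≤ t < l` the box coefficient equals one. -/
lemma intCoeff_ternaryBox_window (cpq : Nat.Coprime p q) (cpr : Nat.Coprime p r)
    (cqr : Nat.Coprime q r) (hp : 2 < p) (hpq : p < q) (hpr : p < r)
    (h1 : (1 : ℤ) = u * (q * r) - V * (r * p) + w * (p * q))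
    (hu : 0 < u) (hV : 0 < V) (hVq : (p : ℤ) ^ 2 * V < q) (hlp : l * u < p)
    {t : ℤ} (ht : 0 ≤ t) (htl : t < l) :
    intCoeff (ternaryBox p q r) ((l - 1) * u * (q * r) - t) = 1 := by
  zify at hp hpq hpr
  have hp0 : (0 : ℤ) < p := by linarith
  have hq0 : (0 : ℤ) < q := by linarith
  have hr0 : (0 : ℤ) < r := by linarith
  have hlu : l ≤ l * u := by nlinarith
  have htp : t < p := by linarith
  have hpV : (p : ℤ) * V < q := by nlinarith
  have hw : w ≤ 0 := by
    by_contra! hw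
    have e1 : (p : ℤ) * q ≤ w * (p * q) := by nlinarith [mul_pos hp0 hq0]
    have e2 : (0 : ℤ) < r * (u * q - V * p) := by
      apply mul_pos hr0
      nlinarith
    nlinarith
  have htV : t * V < q := by nlinarith
  refine intCoeff_ternaryBox_eq_one cpq cpr cqr (a := (l - 1 - t) * u) (b := t * V)
    (c := t * -w) (mul_nonneg (by linarith) hu.le) (by nlinarith) (by positivity) htV
    (mul_nonneg ht (by linarith)) ?_ (by linear_combination (-t) * h1)
  have e : (t * -w) * (p * q) < r * (p * q) := by
    have e1 : (t * -w) * ((p : ℤ) * q) = t * u * (q * r) - t * V * (r * p) - t := by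
      linear_combination t * h1
    have e2 : t * u < p := by nlinarith
    have e3 : t * u * ((q : ℤ) * r) ≤ p * (q * r) :=
      mul_le_mul_of_nonneg_right e2.le (by positivity)
    have e4 : 0 ≤ t * V * ((r : ℤ) * p) := by positivity
    rcases ht.eq_or_lt with rfl | ht0
    · simp only [zero_mul]; positivity
    · linarith
  exact lt_of_mul_lt_mul_right e (by positivity)

lemma intCoeff_ternaryBox_before_window (cpq : Nat.Coprime p q)
    (cqr : Nat.Coprime q r) (hp : 2 < p) (hpq : p < q) (hpr : p < r)
    (h1 : (1 : ℤ) = u * (q * r) - V * (r * p) + w * (p * q))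
    (hV : 0 < V) (hVq : (p : ℤ) ^ 2 * V < q) (hlp : (l - 1) * u ≤ p - 2)
    {t e : ℤ} (ht : t < 0) (htp : -p < t) (he : e ≤ 1) :
    intCoeff (ternaryBox p q r) ((l - 1) * u * (q * r) - t + e * q) = 0 := by
  zify at hp hpq hpr
  have hp0 : (0 : ℤ) < p := by linarith
  have hq0 : (0 : ℤ) < q := by linarith
  have hr0 : (0 : ℤ) < r := by linarith
  refine intCoeff_ternaryBox_eq_zero_of_mod cpq cqr (b := q + t * V) (by nlinarith)
    ⟨(l - 1) * u * r - t * u * r - t * w * p + e - r * p, by linear_combination (-t) * h1⟩ ?_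
  have e1 : (l - 1) * u * ((q : ℤ) * r) ≤ (p - 2) * (q * r) :=
    mul_le_mul_of_nonneg_right hlp (by positivity)
  have e2 : e * q ≤ (q : ℤ) := by nlinarith
  have e3 : -(q : ℤ) < t * V * p := by nlinarith [mul_pos hp0 hV]
  have e4 : -(q : ℤ) * r < t * V * p * r := mul_lt_mul_of_pos_right e3 hr0
  nlinarith

lemma intCoeff_ternaryBox_sub_q (cpq : Nat.Coprime p q) (cpr : Nat.Coprime p r)
    (cqr : Nat.Coprime q r) (hp : 2 < p) (hpq : p < q) (hpr : p < r)
    (h1 : (1 : ℤ) = u * (q * r) - V * (r * p) + w * (p * q))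
    (hq : (1 : ℤ) = s * r + c * p)
    (hu : 0 < u) (hV : 0 < V) (hVq : (p : ℤ) ^ 2 * V < q) (hls : l * u ≤ s)
    (hls' : l * u ≤ p - s) {t : ℤ} (ht : 0 ≤ t) (htl : t < l) :
    intCoeff (ternaryBox p q r) ((l - 1) * u * (q * r) - t - q) = 0 := by
  zify at hp hpq hpr
  have hp0 : (0 : ℤ) < p := by linarith
  have hq0 : (0 : ℤ) < q := by linarith
  have hr0 : (0 : ℤ) < r := by linarith
  have hlu : l ≤ l * u := by nlinarith
  have hpV : (p : ℤ) * V < q := by nlinarith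
  have htu : 0 ≤ t * u := by positivity
  have htu' : 0 ≤ (l - 1 - t) * u := mul_nonneg (by linarith) hu.le
  refine intCoeff_ternaryBox_eq_zero cpq cpr cqr (a := (l - 1 - t) * u - s + p) (b := t * V)
    (by linarith) (by nlinarith)
    ⟨t * V * r - t * w * q - q * c - q * r, by linear_combination (-t) * h1 - (q : ℤ) * hq⟩
    ⟨(l - 1 - t) * u * r - t * w * p - 1, by linear_combination (-t) * h1⟩ ?_
  have e1 : (l - 1) * u * ((q : ℤ) * r) ≤ ((l - 1 - t) * u - s + p) * (q * r) :=
    mul_le_mul_of_nonneg_right (by linarith) (by positivity)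
  have e2 : 0 ≤ t * V * ((r : ℤ) * p) := by positivity
  linarith

lemma intCoeff_ternaryBox_add_q (cpq : Nat.Coprime p q) (cpr : Nat.Coprime p r)
    (cqr : Nat.Coprime q r) (hp : 2 < p) (hpq : p < q) (hpr : p < r)
    (h1 : (1 : ℤ) = u * (q * r) - V * (r * p) + w * (p * q))
    (hq : (1 : ℤ) = s * r + c * p)
    (hu : 0 < u) (hV : 0 < V) (hVq : (p : ℤ) ^ 2 * V < q) (hls : l * u ≤ s)
    (hls' : l * u ≤ p - s) {t : ℤ} (ht : 0 ≤ t) (htl : t < l) :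
    intCoeff (ternaryBox p q r) ((l - 1) * u * (q * r) - t + q) = 0 := by
  zify at hp hpq hpr
  have hp0 : (0 : ℤ) < p := by linarith
  have hq0 : (0 : ℤ) < q := by linarith
  have hr0 : (0 : ℤ) < r := by linarith
  have hlu : l ≤ l * u := by nlinarith
  have hpV : (p : ℤ) * V < q := by nlinarith
  have htu : 0 ≤ t * u := by positivity
  have htu' : 0 ≤ (l - 1 - t) * u := mul_nonneg (by linarith) hu.le
  refine intCoeff_ternaryBox_eq_zero cpq cpr cqr (a := (l - 1 - t) * u + s) (b := t * V)
    (by linarith) (by nlinarith)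
    ⟨t * V * r - t * w * q + q * c, by linear_combination (-t) * h1 + (q : ℤ) * hq⟩
    ⟨(l - 1 - t) * u * r - t * w * p + 1, by linear_combination (-t) * h1⟩ ?_
  have e1 : ((l - 1) * u + 1) * ((q : ℤ) * r) ≤ ((l - 1 - t) * u + s) * (q * r) :=
    mul_le_mul_of_nonneg_right (by linarith) (by positivity)
  have e2 : 0 ≤ t * V * ((r : ℤ) * p) := by positivity
  have e3 : (q : ℤ) < q * r := by nlinarith
  linarith

lemma intCoeff_ternaryBox_sub_r (cpq : Nat.Coprime p q)
    (cqr : Nat.Coprime q r) (hp : 2 < p) (hpq : p < q) (hpr : p < r)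
    (h1 : (1 : ℤ) = u * (q * r) - V * (r * p) + w * (p * q))
    (hr : (1 : ℤ) = s * q + Y * p)
    (hV : 0 < V) (hVq : (p : ℤ) ^ 2 * V < q) (hls : (l - 1) * u < s)
    (hsp : s < p) {t e : ℤ} (ht : t < p) (htp : -p < t) (he : e ≤ 1) :
    intCoeff (ternaryBox p q r) ((l - 1) * u * (q * r) - t - r + e * q) = 0 := by
  zify at hp hpq hpr
  have hp0 : (0 : ℤ) < p := by linarith
  have hq0 : (0 : ℤ) < q := by linarith
  have hr0 : (0 : ℤ) < r := by linarith
  have hpV : 0 < (p : ℤ) * V := mul_pos hp0 hV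
  have f1 : t * (p * V) ≤ (p - 1) * (p * V) := mul_le_mul_of_nonneg_right (by linarith) hpV.le
  have f2 : -(p - 1) * (p * V) ≤ t * (p * V) := mul_le_mul_of_nonneg_right (by linarith) hpV.le
  refine intCoeff_ternaryBox_eq_zero_of_mod cpq cqr (b := t * V - Y) ?_
    ⟨(l - 1) * u * r - t * u * r - t * w * p + e - s * r,
      by linear_combination (-t) * h1 - (r : ℤ) * hr⟩ ?_
  · have : (t * V - Y) * (p : ℤ) < q * p := by nlinarith
    exact lt_of_mul_lt_mul_right this hp0.le
  have e1 : (l - 1) * u * ((q : ℤ) * r) ≤ (s - 1) * (q * r) :=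
    mul_le_mul_of_nonneg_right (by linarith) (by positivity)
  have e2 : e * q ≤ (q : ℤ) := by nlinarith
  have e3 : (t * V - Y) * ((r : ℤ) * p) = r * (t * (p * V) + s * q - 1) := by
    linear_combination (r : ℤ) * hr
  have e4 : (q : ℤ) - t < r * (q + t * (p * V)) := by
    have g : 0 < (q : ℤ) + t * (p * V) := by nlinarith
    rcases le_or_gt 0 t with h0 | h0
    · have := mul_nonneg h0 hpV.le
      nlinarith
    · have g1 : ((p : ℤ) + 1) * (q + t * (p * V)) ≤ r * (q + t * (p * V)) :=
        mul_le_mul_of_nonneg_right (by linarith) g.le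
      have g2 : (p : ℤ) * (p - 1) * (p * V) ≤ (p - 1) * (q - 1) := by nlinarith
      nlinarith
  rw [e3]
  linarith

/-- The window sum at the base index counts the indices with coefficient one. -/
lemma windowSum_eq_natCast (cpq : Nat.Coprime p q) (cpr : Nat.Coprime p r)
    (cqr : Nat.Coprime q r) (hp : 2 < p) (hpq : p < q) (hpr : p < r)
    (h1 : (1 : ℤ) = u * (q * r) - V * (r * p) + w * (p * q))
    (hu : 0 < u) (hV : 0 < V) (hVq : (p : ℤ) ^ 2 * V < q) {l : ℕ} (hl : 0 < l)
    (hlp : l * u ≤ p - 1) :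
    windowSum p q r ((l - 1) * u * (q * r) + (p - l)) = l := by
  have hlp' : (l : ℤ) < p := by nlinarith
  have hl1 : ((l : ℤ) - 1) * u ≤ p - 2 := by linarith
  have hterm : ∀ j ∈ Finset.range p,
      intCoeff (ternaryBox p q r) ((l - 1) * u * (q * r) + (p - l) - j) =
        if p - l ≤ j then 1 else 0 := by
    intro j hj
    have hj := Finset.mem_range.1 hj
    rw [show ((l : ℤ) - 1) * u * (q * r) + (p - l) - j =
      (l - 1) * u * (q * r) - (j - (p - l)) by ring]
    split_ifs with h
    · exact intCoeff_ternaryBox_window cpq cpr cqr hp hpq hpr h1 hu hV hVq (by linarith)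
        (by omega) (by omega)
    · simpa using intCoeff_ternaryBox_before_window cpq cqr hp hpq hpr h1 hV hVq hl1
        (t := j - (p - l)) (e := 0) (by omega) (by omega) (by norm_num)
  rw [windowSum, Finset.sum_congr rfl hterm, ← Finset.sum_filter, Finset.sum_const, nsmul_one]
  have : (Finset.range p).filter (p - l ≤ ·) = Finset.Ico (p - l) p := by
    ext j
    simp only [Finset.mem_filter, Finset.mem_range, Finset.mem_Ico]
    exact and_comm
  rw [this, Nat.card_Ico]
  omega

/-- The window sums at distance `q` from the base index vanish. -/
lemma windowSum_shift_q_eq_zero (cpq : Nat.Coprime p q) (cpr : Nat.Coprime p r)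
    (cqr : Nat.Coprime q r) (hp : 2 < p) (hpq : p < q) (hpr : p < r)
    (h1 : (1 : ℤ) = u * (q * r) - V * (r * p) + w * (p * q))
    (hq : (1 : ℤ) = s * r + c * p)
    (hu : 0 < u) (hV : 0 < V) (hVq : (p : ℤ) ^ 2 * V < q) (hl : 0 < l) (hls : l * u ≤ s)
    (hls' : l * u ≤ p - s) {e : ℤ} (he : e = 1 ∨ e = -1) :
    windowSum p q r ((l - 1) * u * (q * r) + (p - l) + e * q) = 0 := by
  have hlu : l ≤ l * u := by nlinarith
  refine Finset.sum_eq_zero fun j hj => ?_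
  have hj := Finset.mem_range.1 hj
  rw [show (l - 1) * u * ((q : ℤ) * r) + (p - l) + e * q - j =
    (l - 1) * u * (q * r) - (j - (p - l)) + e * q by ring]
  rcases lt_or_ge ((j : ℤ) - (p - l)) 0 with h | h
  · have hls0 : 0 < s := by nlinarith
    have hlp : (l - 1) * u ≤ p - 2 := by linarith
    exact intCoeff_ternaryBox_before_window cpq cqr hp hpq hpr h1 hV hVq hlp h (by omega)
      (by omega)
  · rcases he with rfl | rfl
    · rw [one_mul]
      exact intCoeff_ternaryBox_add_q cpq cpr cqr hp hpq hpr h1 hq hu hV hVq hls hls' h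
        (by omega)
    · rw [neg_one_mul, ← sub_eq_add_neg]
      exact intCoeff_ternaryBox_sub_q cpq cpr cqr hp hpq hpr h1 hq hu hV hVq hls hls' h
        (by omega)

/-- The window sums shifted back by `r`, and possibly by a multiple of `q`, vanish. -/
lemma windowSum_sub_r_eq_zero (cpq : Nat.Coprime p q)
    (cqr : Nat.Coprime q r) (hp : 2 < p) (hpq : p < q) (hpr : p < r)
    (h1 : (1 : ℤ) = u * (q * r) - V * (r * p) + w * (p * q))
    (hr : (1 : ℤ) = s * q + Y * p)
    (hu : 0 < u) (hV : 0 < V) (hVq : (p : ℤ) ^ 2 * V < q) (hl : 0 < l) (hls : l * u ≤ s)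
    (hsp : s < p) {e : ℤ} (he : e ≤ 1) :
    windowSum p q r ((l - 1) * u * (q * r) + (p - l) - r + e * q) = 0 := by
  have hlu : l ≤ l * u := by nlinarith
  refine Finset.sum_eq_zero fun j hj => ?_
  have hj := Finset.mem_range.1 hj
  rw [show (l - 1) * u * ((q : ℤ) * r) + (p - l) - r + e * q - j =
    (l - 1) * u * (q * r) - (j - (p - l)) - r + e * q by ring]
  exact intCoeff_ternaryBox_sub_r cpq cqr hp hpq hpr h1 hr hV hVq (by linarith) hsp
    (by omega) (by omega) he

end window

lemma mem_coeffSet_of_ne_zero (hp : 0 < p) (hq : 0 < q) (hr : 0 < r) {n : ℤ} (hn : n ≠ 0)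
    (m : ℕ) (h : (Qpoly p q r).coeff m = n) : n ∈ coeffSet p q r :=
  ⟨m, (le_natDegree_of_ne_zero (h ▸ hn)).trans (natDegree_Qpoly_le hp hq hr), h⟩

lemma zero_mem_coeffSet (hp : 2 < p) (hpq : p < q) (hpr : p < r)
    (cpq : Nat.Coprime p q) (cpr : Nat.Coprime p r) (cqr : Nat.Coprime q r) :
    (0 : ℤ) ∈ coeffSet p q r := by
  have hqr : q * 1 ≤ q * r := Nat.mul_le_mul_left q (by omega)
  have hpq' : p * 1 < p * q := Nat.mul_lt_mul_of_pos_left (by omega) (by omega)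
  have hpr' : 1 * p < r * p := Nat.mul_lt_mul_of_pos_right (by omega) (by omega)
  have hvanish : ∀ n : ℤ, n ≠ 0 → n ≤ p → intCoeff (ternaryBox p q r) n = 0 := by
    refine fun n hn0 hnp => intCoeff_ternaryBox_eq_zero_of_forall fun a b c ha hb hc e => ?_
    have g1 : (p : ℤ) < q * r := by exact_mod_cast (by omega : p < q * r)
    have g2 : (p : ℤ) < r * p := by exact_mod_cast (by omega : p < r * p)
    have g3 : (p : ℤ) < p * q := by exact_mod_cast (by omega : p < p * q)
    have i1 : 0 ≤ a * ((q : ℤ) * r) := by positivity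
    have i2 : 0 ≤ b * ((r : ℤ) * p) := by positivity
    have i3 : 0 ≤ c * ((p : ℤ) * q) := by positivity
    rcases ha.eq_or_lt with rfl | ha
    · rcases hb.eq_or_lt with rfl | hb
      · rcases hc.eq_or_lt with rfl | hc
        · simp [e] at hn0
        · nlinarith
      · nlinarith
    · nlinarith
  have hw : ∀ n : ℤ, n < 0 → windowSum p q r n = 0 := fun n hn =>
    Finset.sum_eq_zero fun j _ => intCoeff_of_neg _ (by omega)
  have hwp : windowSum p q r p = 0 := Finset.sum_eq_zero fun j hj => by
    have hj := Finset.mem_range.1 hj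
    exact hvanish _ (by omega) (by omega)
  refine ⟨p, ?_, ?_⟩
  · calc p ≤ 1 * (q - 1) * 1 := by omega
      _ ≤ _ := by gcongr <;> omega
  · rw [Qpoly_coeff_eq (by omega) (by omega) (by omega) cpq cpr cqr p
      (by nlinarith), hwp, hw _ (by omega), hw _ (by omega), hw _ (by omega)]
    rfl

/-- If `1 = u q r - V r p + w p q` with `0 < p² V < q`, and `s`, `s'` are the inverses of `r`, `q`
modulo `p`, then `± l` are coefficients as long as `l u` does not exceed `s`, `s'`, `p - s`. -/
lemma natCast_and_neg_mem_coeffSet {u V w s c s' Y : ℤ} (cpq : Nat.Coprime p q)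
    (cpr : Nat.Coprime p r) (cqr : Nat.Coprime q r) (hp : 2 < p) (hpq : p < q) (hpr : p < r)
    (h1 : (1 : ℤ) = u * (q * r) - V * (r * p) + w * (p * q))
    (hq : (1 : ℤ) = s * r + c * p) (hr : (1 : ℤ) = s' * q + Y * p)
    (hu : 0 < u) (hV : 0 < V) (hVq : (p : ℤ) ^ 2 * V < q) {l : ℕ} (hl : 0 < l)
    (hls : l * u ≤ s) (hlsp : l * u ≤ p - s) (hls' : l * u ≤ s') (hsp' : s' < p) :
    (l : ℤ) ∈ coeffSet p q r ∧ -(l : ℤ) ∈ coeffSet p q r := by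
  have hl' : (0 : ℤ) < l := by exact_mod_cast hl
  have hlu : (l : ℤ) ≤ l * u := by nlinarith
  have hlp : (l : ℤ) * u ≤ p - 1 := by linarith
  obtain ⟨m, hm⟩ : ∃ m : ℕ, (m : ℤ) = (l - 1) * u * (q * r) + (p - l) :=
    ⟨(((l : ℤ) - 1) * u * (q * r) + (p - l)).toNat, Int.toNat_of_nonneg <|
      add_nonneg (mul_nonneg (mul_nonneg (by linarith) hu.le) (by positivity)) (by linarith)⟩
  have hmq : m + q < p * q * r := by
    zify at hp hpq hpr ⊢
    have e1 : (l - 1) * u * ((q : ℤ) * r) ≤ (p - 2) * (q * r) :=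
      mul_le_mul_of_nonneg_right (by linarith) (by positivity)
    nlinarith
  have w0 := windowSum_eq_natCast cpq cpr cqr hp hpq hpr h1 hu hV hVq hl hlp
  have wq := fun e he => windowSum_shift_q_eq_zero cpq cpr cqr hp hpq hpr h1 hq hu hV hVq hl'
    hls hlsp (e := e) he
  have wr := fun e he => windowSum_sub_r_eq_zero cpq cqr hp hpq hpr h1 hr hu hV hVq hl'
    hls' hsp' (e := e) he
  rw [← hm] at w0
  simp only [← hm] at wq wr
  have hp0 : 0 < p := by omega
  have hq0 : 0 < q := by omega
  have hr0 : 0 < r := by omega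
  constructor
  · refine mem_coeffSet_of_ne_zero hp0 hq0 hr0 hl'.ne' m ?_
    rw [Qpoly_coeff_eq hp0 hq0 hr0 cpq cpr cqr m (by omega), w0,
      show (m : ℤ) - q = m + -1 * q by ring, wq (-1) (by norm_num),
      show (m : ℤ) - r = m - r + 0 * q by ring, wr 0 (by norm_num),
      show (m : ℤ) + -1 * q - r = m - r + -1 * q by ring, wr (-1) (by norm_num)]
    ring
  · refine mem_coeffSet_of_ne_zero hp0 hq0 hr0 (neg_ne_zero.2 hl'.ne') (m + q) ?_
    rw [Qpoly_coeff_eq hp0 hq0 hr0 cpq cpr cqr (m + q) hmq,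
      show ((m + q : ℕ) : ℤ) - q = m by push_cast; ring, w0,
      show ((m + q : ℕ) : ℤ) = m + 1 * q by push_cast; ring, wq 1 (by norm_num),
      show (m : ℤ) + 1 * q - r = m - r + 1 * q by ring, wr 1 (by norm_num),
      show (m : ℤ) - r = m - r + 0 * q by ring, wr 0 (by norm_num)]
    ring

end

/-- Dividing out the common factor `b` in a representation of `b` by `b * c`, `a * c` and
`a * b`. -/
lemma exists_one_eq_of_eq_self {a b c x y z d : ℤ} (hb : b ≠ 0) (hba : IsCoprime b (a * c))
    (h : b = x * (b * c) + y * (a * c) + z * (a * b) + d * (a * b * c)) :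
    ∃ k, 1 = x * c + k * a := by
  obtain ⟨y', rfl⟩ : b ∣ y := hba.dvd_of_dvd_mul_right
    ⟨1 - x * c - z * a - d * (a * c), by linear_combination -h⟩
  refine ⟨y' * c + z + d * c, mul_left_cancel₀ hb ?_⟩
  linear_combination h

theorem stmt_5 (p q r : ℕ) (hp : 2 < p) (hq : 2 < q) (hr : 2 < r)
    (cpq : Nat.Coprime p q) (cpr : Nat.Coprime p r) (cqr : Nat.Coprime q r)
    (hpq : p < q) (hpr : p < r)
    (x y z δ : ℤ → ℤ)
    (hrep : ∀ n : ℤ,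
      n = x n * ((q : ℤ) * r) + y n * ((p : ℤ) * r) + z n * ((p : ℤ) * q) +
        δ n * ((p : ℤ) * q * r) ∧
      0 ≤ x n ∧ x n < (p : ℤ) ∧ 0 ≤ y n ∧ y n < (q : ℤ) ∧ 0 ≤ z n ∧ z n < (r : ℤ))
    (u v μ C : ℤ) (hu : u = x 1) (hv : v = y 1)
    (hμ : μ = min (min (x q) (x r)) (min ((p : ℤ) - x q) ((p : ℤ) - x r)))
    (hC : C = μ / u)
    (huμ : u ≤ μ) (hqp2 : (p : ℤ) ^ 2 < (q : ℤ))
    (hvbig : (q : ℝ) - (q : ℝ) / (p : ℝ) ^ 2 < (v : ℝ)) :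
    ∀ n : ℤ, |n| ≤ C → n ∈ coeffSet p q r := by
  subst hu hv
  intro n hn
  have hq0 : (q : ℤ) ≠ 0 := by positivity
  have hr0 : (r : ℤ) ≠ 0 := by positivity
  obtain ⟨e1, hu0, -, -, hvq, -⟩ := hrep 1
  obtain ⟨eq, -⟩ := hrep q
  obtain ⟨er, -, hxr, -⟩ := hrep r
  obtain ⟨c, hc⟩ := exists_one_eq_of_eq_self hq0 (isCoprime_mul_cast cpq.symm cqr) eq
  obtain ⟨Y, hY⟩ := exists_one_eq_of_eq_self (a := (p : ℤ)) (b := r) (c := q) (x := x r) (y := z r)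
    (z := y r) (d := δ r) hr0 (isCoprime_mul_cast cpr.symm cqr.symm) (by linear_combination er)
  have hV : (p : ℤ) ^ 2 * (q - y 1) < q := by
    have hpos : (0 : ℝ) < (p : ℝ) ^ 2 := by positivity
    have h : (q : ℝ) - y 1 < q / (p : ℝ) ^ 2 := by linarith
    rw [lt_div_iff₀ hpos, mul_comm] at h
    exact_mod_cast h
  rcases eq_or_ne n 0 with rfl | hn0
  · exact zero_mem_coeffSet hp hpq hpr cpq cpr cqr
  have hl : 0 < n.natAbs := Int.natAbs_pos.2 hn0
  have hlC : (n.natAbs : ℤ) ≤ μ / x 1 := by rwa [Int.natCast_natAbs, ← hC]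
  have hu : 0 < x 1 := by
    refine lt_of_le_of_ne hu0 fun h => ?_
    rw [← h, Int.ediv_zero] at hlC
    omega
  have hlμ : n.natAbs * x 1 ≤ μ := (Int.le_ediv_iff_mul_le hu).1 hlC
  rw [hμ, le_min_iff, le_min_iff, le_min_iff] at hlμ
  obtain ⟨⟨hlq, hlr⟩, hlpq, -⟩ := hlμ
  obtain ⟨hpos, hneg⟩ := natCast_and_neg_mem_coeffSet (V := q - y 1) (w := z 1 + δ 1 * r + r)
    cpq cpr cqr hp hpq hpr (by linear_combination e1) hc hY hu (by linarith) hV hl hlq hlpq hlr hxr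
  obtain h | h := n.natAbs_eq <;> rw [h]
  exacts [hpos, hneg]
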